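/- Let G be a countable discrete amenable group, (V,‖·‖) a complete semi-normed real vector space, π: G → Isom(V) a uniformly bounded representation, and φ ∈ M. If v ∈ V is an additive realization of φ, then the set R_φ of all additive realizations of φ equals the coset v + cl(L), where cl(L) is the ‖·‖-closure of L = span{u − π(g)u : u ∈ V, g ∈ G}. -/

import Mathlib

open scoped Pointwise
open Filter

/-- The collection `F(G)` of non-empty finite subsets of `G`. -/
def FinG (G : Type*) := {F : Finset G // F.Nonempty}

section Defs

variable {G : Type*} [Group G] [DecidableEq G]

/-- `F` is `(K, δ)`-invariant: `|KF Δ F| ≤ δ|F|`. -/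
def IsInv (K : Finset G) (δ : ℝ) (F : Finset G) : Prop :=
  ((symmDiff (K * F) F).card : ℝ) ≤ δ * (F.card : ℝ)

/-- `G` is amenable: for every `(K, δ)` there is a `(K, δ)`-invariant nonempty finite set. -/
def AmenableG (G : Type*) [Group G] [DecidableEq G] : Prop :=
  ∀ K : Finset G, K.Nonempty → ∀ δ : ℝ, 0 < δ →
    ∃ F : Finset G, F.Nonempty ∧ IsInv K δ F

/-- `limsup_{F → G} φ(F) = inf_{(K,δ)} sup {φ(F) : F is (K,δ)-invariant}` (in the extended reals). -/
noncomputable def limsupG (φ : FinG G → ℝ) : EReal :=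
  ⨅ (K : {K : Finset G // K.Nonempty}) (δ : {d : ℝ // 0 < d}),
    ⨆ F : {F : FinG G // IsInv K.1 δ.1 F.1}, (φ F.1 : EReal)

/-- `liminf_{F → G} φ(F) = sup_{(K,δ)} inf {φ(F) : F is (K,δ)-invariant}` (in the extended reals). -/
noncomputable def liminfG (φ : FinG G → ℝ) : EReal :=
  ⨆ (K : {K : Finset G // K.Nonempty}) (δ : {d : ℝ // 0 < d}),
    ⨅ F : {F : FinG G // IsInv K.1 δ.1 F.1}, (φ F.1 : EReal)

/-- `lim_{F → G} φ(F) = L`. -/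
def TendstoG (φ : FinG G → ℝ) (L : ℝ) : Prop :=
  ∀ ε : ℝ, 0 < ε → ∃ (K : Finset G) (δ : ℝ), K.Nonempty ∧ 0 < δ ∧
    ∀ F : FinG G, IsInv K δ F.1 → |φ F - L| < ε

/-- A (left) Følner sequence: `|F_n Δ g F_n| / |F_n| → 0` for every `g ∈ G`. -/
def FolnerSeq (F : ℕ → FinG G) : Prop :=
  ∀ g : G, Filter.Tendsto
    (fun n => ((symmDiff ((F n).1.image (fun h => g * h)) (F n).1).card : ℝ) / ((F n).1.card : ℝ))
    Filter.atTop (nhds (0 : ℝ))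

variable {V : Type*} [SeminormedAddCommGroup V] [NormedSpace ℝ V]

/-- The representation `π` is uniformly bounded with constant `C`. -/
def UnifBdd (π : G →* (V ≃L[ℝ] V)) (C : ℝ) : Prop :=
  ∀ (g : G) (v : V), ‖π g v‖ ≤ C * ‖v‖

/-- The representation `π` is isometric (`C_π = 1`). -/
def IsIsometric (π : G →* (V ≃L[ℝ] V)) : Prop :=
  ∀ (g : G) (v : V), ‖π g v‖ = ‖v‖

/-- The ergodic sum `S_F v = Σ_{g ∈ F} π(g⁻¹) v`. -/
noncomputable def SF (π : G →* (V ≃L[ℝ] V)) (F : Finset G) (v : V) : V :=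
  ∑ g ∈ F, π g⁻¹ v

/-- The ergodic average `A_F v = |F|⁻¹ • S_F v`. -/
noncomputable def AF (π : G →* (V ≃L[ℝ] V)) (F : Finset G) (v : V) : V :=
  (F.card : ℝ)⁻¹ • SF π F v

/-- Right translation `g • F = F g⁻¹` on nonempty finite subsets. -/
def rT (g : G) (F : FinG G) : FinG G :=
  ⟨F.1.image (fun h => h * g⁻¹), F.2.image (fun h => h * g⁻¹)⟩

/-- `G`-equivariance of a set map: `π(g) φ(F) = φ(F g⁻¹)`. -/
def IsEquivariant (π : G →* (V ≃L[ℝ] V)) (φ : FinG G → V) : Prop :=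
  ∀ (g : G) (F : FinG G), π g (φ F) = φ (rT g F)

/-- Boundedness of a set map: `sup_F ‖φ(F)‖/|F| < ∞`. -/
def IsBddMap (φ : FinG G → V) : Prop :=
  ∃ C : ℝ, ∀ F : FinG G, ‖φ F‖ ≤ C * (F.1.card : ℝ)

/-- Membership in the space `M` of bounded `G`-equivariant set maps. -/
def MemM (π : G →* (V ≃L[ℝ] V)) (φ : FinG G → V) : Prop :=
  IsBddMap φ ∧ IsEquivariant π φ

/-- The sup seminorm `|||φ|||_sup = sup_F ‖φ(F)‖/|F|`. -/
noncomputable def supNorm (φ : FinG G → V) : ℝ :=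
  ⨆ F : FinG G, ‖φ F‖ / (F.1.card : ℝ)

/-- The asymptotic seminorm `|||φ|||_G = limsup_{F → G} ‖φ(F)‖/|F|` (in the extended reals). -/
noncomputable def normG (φ : FinG G → V) : EReal :=
  limsupG (fun F => ‖φ F‖ / (F.1.card : ℝ))

/-- Union of nonempty finite subsets. -/
def unionF (E F : FinG G) : FinG G :=
  ⟨E.1 ∪ F.1, E.2.inl⟩

/-- Additive set maps: `φ(E ⊔ F) = φ(E) + φ(F)` for disjoint `E, F`. -/
def IsAdditiveMap (φ : FinG G → V) : Prop :=
  ∀ E F : FinG G, Disjoint E.1 F.1 → φ (unionF E F) = φ E + φ F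

/-- The additive set map `S(v)(F) = S_F v`. -/
noncomputable def Smap (π : G →* (V ≃L[ℝ] V)) (v : V) : FinG G → V :=
  fun F => SF π F.1 v

/-- The coboundary subspace `L_W = span{w − π(g)w : w ∈ W, g ∈ G}`. -/
def cobSpan (π : G →* (V ≃L[ℝ] V)) (W : Set V) : Submodule ℝ V :=
  Submodule.span ℝ {x | ∃ w ∈ W, ∃ g : G, x = w - π g w}

/-- The coboundary subspace `L = L_V`. -/
def cobL (π : G →* (V ≃L[ℝ] V)) : Submodule ℝ V :=
  cobSpan π Set.univ

/-- The quotient seminorm `‖v + U‖_U = inf_{u ∈ U} ‖v + u‖`. -/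
noncomputable def qnorm (U : Set V) (v : V) : ℝ :=
  ⨅ u : U, ‖v + u.1‖

/-- `v` is an additive realization of `φ`: `lim_{F→G} ‖φ(F)/|F| − A_F v‖ = 0`. -/
def IsRealization (π : G →* (V ≃L[ℝ] V)) (φ : FinG G → V) (v : V) : Prop :=
  TendstoG (fun F => ‖(F.1.card : ℝ)⁻¹ • φ F - AF π F.1 v‖) 0

/-- `φ` is asymptotically additive: `inf_{ψ ∈ M_⊕} |||φ − ψ|||_G = 0`. -/
def AsympAdd (π : G →* (V ≃L[ℝ] V)) (φ : FinG G → V) : Prop :=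
  (⨅ ψ : {ψ : FinG G → V // MemM π ψ ∧ IsAdditiveMap ψ}, normG (φ - ψ.1)) = (0 : EReal)

/-- `φ` is asymptotically additive relative to `W`. -/
def AsympAddRel (π : G →* (V ≃L[ℝ] V)) (W : Set V) (φ : FinG G → V) : Prop :=
  (⨅ w : W, limsupG (fun F => ‖(F.1.card : ℝ)⁻¹ • φ F - AF π F.1 w.1‖)) = (0 : EReal)

/-- The quotient norm on `M_⊕ / N_⊕`. -/
noncomputable def qMplusN (π : G →* (V ≃L[ℝ] V)) (ψ : FinG G → V) : ℝ :=
  ⨅ η : {η : FinG G → V // MemM π η ∧ IsAdditiveMap η ∧ normG η = (0 : EReal)},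
    supNorm (ψ + η.1)

end Defs

lemma FinG.card_pos {G : Type*} (F : FinG G) : (0 : ℝ) < F.1.card := by
  exact_mod_cast F.2.card_pos

section Averages

variable {G : Type*} [Group G] {V : Type*} [SeminormedAddCommGroup V] [NormedSpace ℝ V]
  {π : G →* (V ≃L[ℝ] V)} {C : ℝ}

lemma AF_add (F : Finset G) (u w : V) : AF π F (u + w) = AF π F u + AF π F w := by
  simp [AF, SF, Finset.sum_add_distrib]

lemma AF_sub (F : Finset G) (u w : V) : AF π F (u - w) = AF π F u - AF π F w := by
  simp [AF, SF, Finset.sum_sub_distrib, smul_sub]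

lemma AF_smul (F : Finset G) (a : ℝ) (u : V) : AF π F (a • u) = a • AF π F u := by
  simp [AF, SF, ← Finset.smul_sum, smul_comm a]

lemma UnifBdd.abs (hπ : UnifBdd π C) (g : G) (u : V) : ‖π g u‖ ≤ |C| * ‖u‖ :=
  (hπ g u).trans (mul_le_mul_of_nonneg_right (le_abs_self C) (norm_nonneg u))

lemma UnifBdd.norm_SF_le (hπ : UnifBdd π C) (F : Finset G) (u : V) :
    ‖SF π F u‖ ≤ F.card * (|C| * ‖u‖) := by
  simpa [SF, nsmul_eq_mul] using norm_sum_le_of_le F (fun g _ => hπ.abs g⁻¹ u)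

lemma UnifBdd.norm_AF_le (hπ : UnifBdd π C) (F : FinG G) (u : V) :
    ‖AF π F.1 u‖ ≤ |C| * ‖u‖ := by
  rw [AF, norm_smul, norm_inv, Real.norm_natCast, inv_mul_le_iff₀ F.card_pos]
  exact hπ.norm_SF_le F.1 u

lemma sub_AF_mem_cobL (F : FinG G) (u : V) : u - AF π F.1 u ∈ cobL π := by
  have hu : u = (F.1.card : ℝ)⁻¹ • ∑ _g ∈ F.1, u := by
    rw [Finset.sum_const, ← Nat.cast_smul_eq_nsmul ℝ, inv_smul_smul₀ F.card_pos.ne']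
  have h : u - AF π F.1 u = (F.1.card : ℝ)⁻¹ • ∑ g ∈ F.1, (u - π g⁻¹ u) := by
    rw [Finset.sum_sub_distrib, smul_sub, ← hu, AF, SF]
  rw [h]
  exact Submodule.smul_mem _ _ (Submodule.sum_mem _ fun g _ =>
    Submodule.subset_span ⟨u, Set.mem_univ u, g⁻¹, rfl⟩)

end Averages

section Invariance

variable {G : Type*} [Group G] [DecidableEq G]

lemma card_sdiff_mul_le {K F : Finset G} {g : G} (hg : g ∈ K) :
    (F \ (K * F)).card ≤ ((K * F) \ F).card := by
  have hsub : g • F ⊆ K * F := by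
    intro x hx
    obtain ⟨y, hy, rfl⟩ := Finset.mem_smul_finset.1 hx
    exact Finset.mul_mem_mul hg hy
  calc (F \ (K * F)).card ≤ (F \ (g • F)).card :=
        Finset.card_le_card (Finset.sdiff_subset_sdiff le_rfl hsub)
    _ = ((g • F) \ F).card := Finset.card_sdiff_comm (Finset.card_smul_finset g F).symm
    _ ≤ ((K * F) \ F).card := Finset.card_le_card (Finset.sdiff_subset_sdiff hsub le_rfl)

/-- Invariance passes to non-empty subsets of `K`, up to a factor `2`. -/
lemma IsInv.mono {K K' F : Finset G} {δ : ℝ} (h : IsInv K' δ F) (hK : K.Nonempty)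
    (hKK' : K ⊆ K') : IsInv K (2 * δ) F := by
  obtain ⟨g, hg⟩ := hK
  unfold IsInv at *
  have h₁ : (symmDiff (K * F) F).card ≤ 2 * (symmDiff (K' * F) F).card := by
    calc (symmDiff (K * F) F).card ≤ ((K * F) \ F).card + (F \ (K * F)).card :=
          Finset.card_union_le _ _
      _ ≤ 2 * ((K * F) \ F).card := by have := card_sdiff_mul_le (F := F) hg; omega
      _ ≤ 2 * (symmDiff (K' * F) F).card := by
          gcongr
          exact (Finset.sdiff_subset_sdiff (Finset.mul_subset_mul_right hKK') le_rfl).trans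
            Finset.subset_union_left
  have h₂ : ((symmDiff (K * F) F).card : ℝ) ≤ 2 * (symmDiff (K' * F) F).card := by
    exact_mod_cast h₁
  linarith

lemma TendstoG.of_le_add {f g h : FinG G → ℝ} (hf : TendstoG f 0) (hg : TendstoG g 0)
    (hle : ∀ F, |h F| ≤ |f F| + |g F|) : TendstoG h 0 := by
  intro ε hε
  obtain ⟨K₁, δ₁, hK₁, hδ₁, h₁⟩ := hf (ε / 2) (half_pos hε)
  obtain ⟨K₂, δ₂, hK₂, hδ₂, h₂⟩ := hg (ε / 2) (half_pos hε)
  refine ⟨K₁ ∪ K₂, min δ₁ δ₂ / 2, hK₁.inl, half_pos (lt_min hδ₁ hδ₂), fun F hF => ?_⟩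
  have weaken {K : Finset G} {δ : ℝ} (hK : K.Nonempty) (hsub : K ⊆ K₁ ∪ K₂)
      (hδ : min δ₁ δ₂ ≤ δ) : IsInv K δ F.1 := by
    have := hF.mono hK hsub
    unfold IsInv at *
    refine this.trans ?_
    gcongr
    linarith
  have e₁ := h₁ F (weaken hK₁ Finset.subset_union_left (min_le_left _ _))
  have e₂ := h₂ F (weaken hK₂ Finset.subset_union_right (min_le_right _ _))
  have := hle F
  simp only [sub_zero] at *
  linarith

variable {V : Type*} [SeminormedAddCommGroup V] [NormedSpace ℝ V]
  {π : G →* (V ≃L[ℝ] V)} {C : ℝ}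

lemma SF_apply (F : Finset G) (g : G) (w : V) : SF π F (π g w) = SF π (g⁻¹ • F) w := by
  have : g⁻¹ • F = F.image (fun h => g⁻¹ * h) := rfl
  rw [this, SF, SF, Finset.sum_image (fun a _ b _ h => mul_left_cancel h)]
  refine Finset.sum_congr rfl fun h _ => ?_
  rw [mul_inv_rev, inv_inv, map_mul]
  rfl

lemma UnifBdd.norm_SF_sub_SF_le (hπ : UnifBdd π C) (E F : Finset G) (u : V) :
    ‖SF π E u - SF π F u‖ ≤ (symmDiff E F).card * (|C| * ‖u‖) := by
  have hcard : (symmDiff E F).card = (E \ F).card + (F \ E).card :=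
    Finset.card_union_of_disjoint disjoint_sdiff_sdiff
  have hsub : SF π E u - SF π F u = SF π (E \ F) u - SF π (F \ E) u :=
    (Finset.sum_sdiff_sub_sum_sdiff (s₁ := F) (s₂ := E)).symm
  rw [hsub, hcard, Nat.cast_add, add_mul]
  exact (norm_sub_le _ _).trans (add_le_add (hπ.norm_SF_le _ _) (hπ.norm_SF_le _ _))

lemma UnifBdd.tendstoG_sub_apply (hπ : UnifBdd π C) (w : V) (g : G) :
    TendstoG (fun F => ‖AF π F.1 (w - π g w)‖) 0 := by
  intro ε hε
  have hB : 0 < |C| * ‖w‖ + 1 := by positivity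
  refine ⟨{g⁻¹}, ε / 2 / (|C| * ‖w‖ + 1), Finset.singleton_nonempty _, by positivity,
    fun F hF => ?_⟩
  have hF' : ((symmDiff (g⁻¹ • F.1) F.1).card : ℝ) ≤ ε / 2 / (|C| * ‖w‖ + 1) * F.1.card := by
    simpa [IsInv, Finset.singleton_mul] using hF
  have hS := hπ.norm_SF_sub_SF_le F.1 (g⁻¹ • F.1) w
  rw [symmDiff_comm] at hS
  rw [sub_zero, abs_norm, AF_sub, AF, AF, SF_apply, ← smul_sub, norm_smul, norm_inv,
    Real.norm_natCast]
  have hle : ‖SF π F.1 w - SF π (g⁻¹ • F.1) w‖ ≤ F.1.card * (ε / 2) := by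
    calc _ ≤ _ := hS
      _ ≤ (ε / 2 / (|C| * ‖w‖ + 1) * F.1.card) * (|C| * ‖w‖ + 1) := by
          gcongr
          linarith
      _ = F.1.card * (ε / 2) := by field_simp
  have := (inv_mul_le_iff₀ F.card_pos).2 hle
  linarith

lemma UnifBdd.tendstoG_of_mem_cobL (hπ : UnifBdd π C) {u : V} (hu : u ∈ cobL π) :
    TendstoG (fun F => ‖AF π F.1 u‖) 0 := by
  induction hu using Submodule.span_induction with
  | mem x hx =>
    obtain ⟨w, -, g, rfl⟩ := hx
    exact hπ.tendstoG_sub_apply w g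
  | zero => simpa using hπ.tendstoG_sub_apply (0 : V) 1
  | add x y _ _ hx hy =>
    refine hx.of_le_add hy fun F => ?_
    simp only [abs_norm, AF_add]
    exact norm_add_le _ _
  | smul a x _ hx =>
    intro ε hε
    obtain ⟨K, δ, hK, hδ, h⟩ := hx (ε / (|a| + 1)) (by positivity)
    refine ⟨K, δ, hK, hδ, fun F hF => ?_⟩
    have := h F hF
    rw [sub_zero, abs_norm, lt_div_iff₀ (by positivity)] at this
    rw [sub_zero, abs_norm, AF_smul, norm_smul, Real.norm_eq_abs]
    nlinarith [norm_nonneg (AF π F.1 x)]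

lemma UnifBdd.tendstoG_of_mem_closure (hπ : UnifBdd π C) {u : V}
    (hu : u ∈ closure (cobL π : Set V)) : TendstoG (fun F => ‖AF π F.1 u‖) 0 := by
  intro ε hε
  obtain ⟨x, hx, hux⟩ := Metric.mem_closure_iff.1 hu (ε / 2 / (|C| + 1)) (by positivity)
  obtain ⟨K, δ, hK, hδ, h⟩ := hπ.tendstoG_of_mem_cobL hx (ε / 2) (half_pos hε)
  refine ⟨K, δ, hK, hδ, fun F hF => ?_⟩
  have h₁ := h F hF
  rw [dist_eq_norm, lt_div_iff₀ (by positivity)] at hux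
  have h₂ := hπ.norm_AF_le F (u - x)
  have h₃ : ‖AF π F.1 u‖ ≤ ‖AF π F.1 (u - x)‖ + ‖AF π F.1 x‖ := by
    simpa [AF_sub] using norm_add_le (AF π F.1 (u - x)) (AF π F.1 x)
  simp only [sub_zero, abs_norm] at *
  nlinarith [norm_nonneg (u - x)]

lemma mem_closure_cobL_of_tendstoG (hG : AmenableG G) {u : V}
    (hu : TendstoG (fun F => ‖AF π F.1 u‖) 0) : u ∈ closure (cobL π : Set V) := by
  refine Metric.mem_closure_iff.2 fun ε hε => ?_
  obtain ⟨K, δ, hK, hδ, h⟩ := hu ε hε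
  obtain ⟨F, hF, hinv⟩ := hG K hK δ hδ
  refine ⟨_, sub_AF_mem_cobL ⟨F, hF⟩ u, ?_⟩
  simpa [dist_eq_norm] using h ⟨F, hF⟩ hinv

/-- The averages of `u` tend to zero exactly when `u` is in the closure of the coboundaries. -/
lemma UnifBdd.tendstoG_iff_mem_closure (hπ : UnifBdd π C) (hG : AmenableG G) {u : V} :
    TendstoG (fun F => ‖AF π F.1 u‖) 0 ↔ u ∈ closure (cobL π : Set V) :=
  ⟨mem_closure_cobL_of_tendstoG hG, hπ.tendstoG_of_mem_closure⟩

lemma IsRealization.iff_tendstoG_sub {φ : FinG G → V} {v : V} (hv : IsRealization π φ v) (w : V) :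
    IsRealization π φ w ↔ TendstoG (fun F => ‖AF π F.1 (w - v)‖) 0 := by
  constructor
  · intro hw
    refine TendstoG.of_le_add hv hw fun F => ?_
    simp only [abs_norm, AF_sub]
    refine le_of_eq_of_le (congrArg norm ?_) (norm_sub_le _ _)
    abel
  · intro hw
    refine TendstoG.of_le_add hv hw fun F => ?_
    simp only [abs_norm, AF_sub]
    refine le_of_eq_of_le (congrArg norm ?_) (norm_sub_le _ _)
    abel

end Invariance

theorem statement10 {G : Type*} [Group G] [DecidableEq G] [Countable G]
    {V : Type*} [SeminormedAddCommGroup V] [NormedSpace ℝ V] [CompleteSpace V]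
    (hG : AmenableG G) (π : G →* (V ≃L[ℝ] V)) (C : ℝ) (hπ : UnifBdd π C)
    (φ : FinG G → V) (hφ : MemM π φ) (v : V) (hv : IsRealization π φ v) :
    {w : V | IsRealization π φ w} =
      {w : V | ∃ u ∈ closure (cobL π : Set V), w = v + u} := by
  ext w
  rw [Set.mem_ofPred_eq, Set.mem_ofPred_eq, hv.iff_tendstoG_sub, hπ.tendstoG_iff_mem_closure hG]
  constructor
  · exact fun h => ⟨w - v, h, (add_sub_cancel v w).symm⟩
  · rintro ⟨u, hu, rfl⟩
    rwa [add_sub_cancel_left]
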